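/- Let G be a tripartite simple graph with vertex partition (A, B, C) such that A, B, C are independent sets, and let G' be the graph obtained from G as follows: add all edges inside A, inside B, and inside C (turning each part into a clique); add three new vertices r_A, r_B, r_C, where r_A is adjacent exactly to all vertices of A, r_B to all vertices of B, and r_C to all vertices of C; and add a new vertex s adjacent exactly to r_A, r_B, and r_C. Then for every set U ⊆ A ∪ B ∪ C, U is a vertex cover of G if and only if no cycle of G' − U contains the vertex s. -/

import Mathlib

/-- The graph `G'` built from a tripartite graph `G` with parts `A, B, C`: each part is turned
into a clique, new vertices `r_A = Sum.inr 0`, `r_B = Sum.inr 1`, `r_C = Sum.inr 2` are adjacent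
exactly to the vertices of `A`, `B`, `C` respectively, and a new vertex `s = Sum.inr 3` is
adjacent exactly to `r_A, r_B, r_C`. -/
def Gprime {V : Type*} (G : SimpleGraph V) (A B C : Set V) : SimpleGraph (V ⊕ Fin 4) :=
  SimpleGraph.fromRel fun a b =>
    match a, b with
    | Sum.inl u, Sum.inl v =>
        G.Adj u v ∨ (u ∈ A ∧ v ∈ A) ∨ (u ∈ B ∧ v ∈ B) ∨ (u ∈ C ∧ v ∈ C)
    | Sum.inl u, Sum.inr i => (i = 0 ∧ u ∈ A) ∨ (i = 1 ∧ u ∈ B) ∨ (i = 2 ∧ u ∈ C)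
    | Sum.inr i, Sum.inr j => i = 3 ∧ (j = 0 ∨ j = 1 ∨ j = 2)
    | _, _ => False

/-- The part attached to the new vertex `Sum.inr i` of `Gprime G A B C`. -/
def tripart {V : Type*} (A B C : Set V) : Fin 4 → Set V := ![A, B, C, ∅]

/-- The vertices of `Gprime G A B C` lying in the `i`-th part or equal to its root. -/
def rootedPart {V : Type*} (A B C : Set V) (i : Fin 4) : Set (V ⊕ Fin 4) :=
  Sum.elim (fun u => u ∈ tripart A B C i) (fun j => j = i)

section Gprime

variable {V : Type*} {G : SimpleGraph V} {A B C : Set V}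

lemma Gprime_adj_inr_inr {i j : Fin 4} :
    (Gprime G A B C).Adj (Sum.inr i) (Sum.inr j) ↔ (i = 3 ∧ j ≠ 3) ∨ (i ≠ 3 ∧ j = 3) := by
  simp only [Gprime, SimpleGraph.fromRel_adj, ne_eq, Sum.inr.injEq]
  revert i j
  decide

lemma Gprime_adj_inl_inr {u : V} {i : Fin 4} :
    (Gprime G A B C).Adj (Sum.inl u) (Sum.inr i) ↔ u ∈ tripart A B C i := by
  fin_cases i <;> simp [Gprime, tripart]

lemma Gprime_adj_inl_inl {u v : V} :
    (Gprime G A B C).Adj (Sum.inl u) (Sum.inl v) ↔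
      u ≠ v ∧ (G.Adj u v ∨ ∃ i, u ∈ tripart A B C i ∧ v ∈ tripart A B C i) := by
  simp only [Gprime, SimpleGraph.fromRel_adj, tripart, Fin.exists_fin_succ, G.adj_comm v u]
  simp
  tauto

lemma tripart_index_unique (hAB : Disjoint A B) (hAC : Disjoint A C) (hBC : Disjoint B C)
    {u : V} {i j : Fin 4} (hi : u ∈ tripart A B C i) (hj : u ∈ tripart A B C j) : i = j := by
  rw [Set.disjoint_left] at hAB hAC hBC
  fin_cases i <;> fin_cases j <;> simp_all [tripart]

/-- If `U` covers `G`, then away from `U` and from the edge joining `s` to the `i`-th root,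
adjacency in `Gprime` does not leave the `i`-th rooted part. -/
lemma mem_rootedPart_of_adj (hAB : Disjoint A B) (hAC : Disjoint A C) (hBC : Disjoint B C)
    {U : Set V} (hcover : ∀ u v : V, G.Adj u v → u ∈ U ∨ v ∈ U) {i : Fin 4} (hi : i ≠ 3)
    {x y : V ⊕ Fin 4} (hx : x ∉ Sum.inl '' U) (hy : y ∉ Sum.inl '' U)
    (hxy : (Gprime G A B C).Adj x y)
    (hne : s(x, y) ≠ s(Sum.inr 3, Sum.inr i)) (hxi : x ∈ rootedPart A B C i) :
    y ∈ rootedPart A B C i := by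
  rcases x with u | j <;> rcases y with v | k
  · rw [Gprime_adj_inl_inl] at hxy
    obtain ⟨-, h | ⟨k, hu, hv⟩⟩ := hxy
    · rcases hcover u v h with h | h
      · exact (hx ⟨u, h, rfl⟩).elim
      · exact (hy ⟨v, h, rfl⟩).elim
    · obtain rfl := tripart_index_unique hAB hAC hBC hxi hu
      exact hv
  · rw [Gprime_adj_inl_inr] at hxy
    exact (tripart_index_unique hAB hAC hBC hxi hxy).symm
  · rw [SimpleGraph.adj_comm, Gprime_adj_inl_inr] at hxy
    obtain rfl : j = i := hxi
    exact hxy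
  · obtain rfl : j = i := hxi
    rw [Gprime_adj_inr_inr] at hxy
    obtain ⟨h, -⟩ | ⟨-, rfl⟩ := hxy
    · exact (hi h).elim
    · exact (hne Sym2.eq_swap).elim

end Gprime

lemma SimpleGraph.mem_of_reachable_of_adj_closed {W : Type*} {H : SimpleGraph W} {S : Set W}
    (hS : ∀ x y, H.Adj x y → x ∈ S → y ∈ S) {x y : W} (h : H.Reachable x y) (hx : x ∈ S) :
    y ∈ S := by
  obtain ⟨p⟩ := h
  induction p with
  | nil => exact hx
  | cons hadj _ ih => exact ih (hS _ _ hadj hx)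

lemma SimpleGraph.exists_isCycle_of_five {W : Type*} {H : SimpleGraph W} {a b c d e : W}
    (hab : H.Adj a b) (hbc : H.Adj b c) (hcd : H.Adj c d) (hde : H.Adj d e) (hea : H.Adj e a)
    (hac : a ≠ c) (had : a ≠ d) (hbd : b ≠ d) (hbe : b ≠ e) (hce : c ≠ e) :
    ∃ p : H.Walk a a, p.IsCycle := by
  refine ⟨.cons hab (.cons hbc (.cons hcd (.cons hde (.cons hea .nil)))), ?_⟩
  have := hab.ne
  have := hbc.ne
  have := hcd.ne
  have := hde.ne
  have := hea.ne
  rw [SimpleGraph.Walk.cons_isCycle_iff]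
  constructor
  · simp; grind
  · simp; grind

/-- For a tripartite graph `G` with independent parts `A, B, C` and the graph
`G'` described above, a set `U ⊆ A ∪ B ∪ C` is a vertex cover of `G` if and only if no cycle of
`G' − U` contains the vertex `s`. -/
theorem stmt8 {V : Type*} (G : SimpleGraph V) (A B C : Set V)
    (hcov : A ∪ B ∪ C = Set.univ)
    (hAB : Disjoint A B) (hAC : Disjoint A C) (hBC : Disjoint B C)
    (hA : A.Pairwise fun u v => ¬ G.Adj u v)
    (hB : B.Pairwise fun u v => ¬ G.Adj u v)
    (hC : C.Pairwise fun u v => ¬ G.Adj u v)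
    (U : Set V) (hU : U ⊆ A ∪ B ∪ C) :
    (∀ u v : V, G.Adj u v → u ∈ U ∨ v ∈ U) ↔
      (∀ (a : ↥((Sum.inl '' U : Set (V ⊕ Fin 4))ᶜ))
        (c : ((Gprime G A B C).induce (Sum.inl '' U : Set (V ⊕ Fin 4))ᶜ).Walk a a),
        c.IsCycle → ∀ b ∈ c.support, (b : V ⊕ Fin 4) ≠ Sum.inr 3) := by
  constructor
  · rintro hcover a c hc ⟨b, hbU⟩ hb rfl
    obtain ⟨e, he, hbe⟩ := (SimpleGraph.Walk.mem_support_iff_exists_mem_edges_of_not_nil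
      hc.not_nil).1 hb
    obtain ⟨⟨x, hxU⟩, rfl⟩ := Sym2.mem_iff_exists.1 hbe
    have hadj : (Gprime G A B C).Adj (Sum.inr 3) x := c.adj_of_mem_edges he
    obtain ⟨i, hi, rfl⟩ : ∃ i : Fin 4, i ≠ 3 ∧ x = Sum.inr i := by
      rcases x with u | i
      · rw [SimpleGraph.adj_comm, Gprime_adj_inl_inr] at hadj
        simp [tripart] at hadj
      · rw [Gprime_adj_inr_inr] at hadj
        exact ⟨i, by simpa using hadj, rfl⟩
    refine (SimpleGraph.isBridge_iff_forall_cycle_notMem (c.edges_subset_edgeSet he)).1 ?_ c hc he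
    rw [SimpleGraph.isBridge_iff]
    intro hreach
    have hmem := SimpleGraph.mem_of_reachable_of_adj_closed
      (S := Subtype.val ⁻¹' rootedPart A B C i) ?_ hreach.symm (by rfl)
    · exact hi (Eq.symm hmem)
    · rintro ⟨y, hy⟩ ⟨z, hz⟩ hyz hyi
      rw [SimpleGraph.deleteEdges_adj] at hyz
      refine mem_rootedPart_of_adj hAB hAC hBC hcover hi hy hz hyz.1 (fun h => hyz.2 ?_) hyi
      simpa using h
  · intro hcycle u v huv
    by_contra! hUV
    obtain ⟨hu, hv⟩ := hUV
    have hpart (w : V) : ∃ i : Fin 4, i ≠ 3 ∧ w ∈ tripart A B C i := by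
      have hw : w ∈ A ∪ B ∪ C := hcov ▸ Set.mem_univ w
      rcases hw with (hw | hw) | hw
      exacts [⟨0, by decide, hw⟩, ⟨1, by decide, hw⟩, ⟨2, by decide, hw⟩]
    have hindep (i : Fin 4) : (tripart A B C i).Pairwise fun u v => ¬ G.Adj u v := by
      fin_cases i
      exacts [hA, hB, hC, Set.pairwise_empty _]
    obtain ⟨i, hi, hui⟩ := hpart u
    obtain ⟨j, hj, hvj⟩ := hpart v
    have hij : i ≠ j := by
      rintro rfl
      exact hindep i hui hvj huv.ne huv
    have hinr (k : Fin 4) : (Sum.inr k : V ⊕ Fin 4) ∈ (Sum.inl '' U)ᶜ := by simp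
    have hinl {w : V} (hw : w ∉ U) : (Sum.inl w : V ⊕ Fin 4) ∈ (Sum.inl '' U)ᶜ := by simpa
    have hroot {k : Fin 4} (hk : k ≠ 3) :
        (Gprime G A B C).Adj (Sum.inr 3) (Sum.inr k) :=
      Gprime_adj_inr_inr.2 (Or.inl ⟨rfl, hk⟩)
    have hleaf {w : V} {k : Fin 4} (hw : w ∈ tripart A B C k) :
        (Gprime G A B C).Adj (Sum.inl w) (Sum.inr k) :=
      Gprime_adj_inl_inr.2 hw
    have hedge : (Gprime G A B C).Adj (Sum.inl u) (Sum.inl v) :=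
      Gprime_adj_inl_inl.2 ⟨huv.ne, Or.inl huv⟩
    obtain ⟨p, hp⟩ := SimpleGraph.exists_isCycle_of_five
      (H := (Gprime G A B C).induce (Sum.inl '' U : Set (V ⊕ Fin 4))ᶜ)
      (a := ⟨_, hinr 3⟩) (b := ⟨_, hinr i⟩) (c := ⟨_, hinl hu⟩) (d := ⟨_, hinl hv⟩)
      (e := ⟨_, hinr j⟩)
      (hroot hi) (hleaf hui).symm hedge (hleaf hvj) (hroot hj).symm
      (by simp) (by simp) (by simp) (by simpa using hij) (by simp)
    exact hcycle _ p hp _ p.start_mem_support rfl
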